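/- Let E be a nonempty topological space, and let π : E → S¹ be a fiber bundle projection with fiber the 2-torus T² = S¹ × S¹. Then for any basepoint e ∈ E, the fundamental group π₁(E, e) is not a cyclic group. -/

import Mathlib

open Set unitInterval

/-- The pullback of `π : E → B` along `f : ℝ → B` is trivial with fiber `F` over `S ⊆ ℝ`:
there is a continuous map `r` from the pullback to `F` restricting to a homeomorphism on each
fiber, with inverse `s t` on the fiber over `t`. -/
def PullbackTrivialOn {E B : Type*} (F : Type*) [TopologicalSpace E] [TopologicalSpace F]
    (π : E → B) (f : ℝ → B) (S : Set ℝ) : Prop :=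
  ∃ (r : ℝ × E → F) (s : ℝ → F → E),
    ContinuousOn r {p | p.1 ∈ S ∧ π p.2 = f p.1} ∧
      ∀ t ∈ S, Continuous (s t) ∧ (∀ z, π (s t z) = f t) ∧ (∀ z, r (t, s t z) = z) ∧
        ∀ x, π x = f t → s t (r (t, x)) = x

namespace PullbackTrivialOn

variable {E B F : Type*} [TopologicalSpace E] [TopologicalSpace F] {π : E → B}
  {f : ℝ → B}

lemma mono {S T : Set ℝ} (h : PullbackTrivialOn F π f T) (hST : S ⊆ T) :
    PullbackTrivialOn F π f S := by
  obtain ⟨r, s, hr, hs⟩ := h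
  exact ⟨r, s, hr.mono fun p hp ↦ ⟨hST hp.1, hp.2⟩, fun t ht ↦ hs t (hST ht)⟩

lemma of_homeomorph [TopologicalSpace B] [Nonempty E] [Nonempty F] {U : Set B}
    (h : (π ⁻¹' U) ≃ₜ U × F)
    (hh : ∀ x : π ⁻¹' U, ((h x).1 : B) = π x)
    {S : Set ℝ} (hS : ∀ t ∈ S, f t ∈ U) :
    PullbackTrivialOn F π f S := by
  classical
  have hsymm (u : U × F) : π (h.symm u) = u.1 := by rw [← hh, h.apply_symm_apply]
  refine ⟨fun p ↦ if hp : p.2 ∈ π ⁻¹' U then (h ⟨p.2, hp⟩).2 else Classical.arbitrary F,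
    fun t z ↦ if ht : f t ∈ U then h.symm (⟨f t, ht⟩, z) else Classical.arbitrary E, ?_, ?_⟩
  · have hmem : ∀ p ∈ {p : ℝ × E | p.1 ∈ S ∧ π p.2 = f p.1}, p.2 ∈ π ⁻¹' U :=
      fun p hp ↦ by rw [mem_preimage, hp.2]; exact hS _ hp.1
    rw [continuousOn_iff_continuous_domRestrict]
    have hc : Continuous fun p : {p : ℝ × E | p.1 ∈ S ∧ π p.2 = f p.1} ↦
        (h ⟨p.1.2, hmem p.1 p.2⟩).2 := by fun_prop
    refine hc.congr fun p ↦ ?_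
    simp only [domRestrict_apply]
    rw [dif_pos (hmem p.1 p.2)]
  · intro t ht
    have hU := hS t ht
    simp only [dif_pos hU]
    refine ⟨by fun_prop, fun z ↦ hsymm _, fun z ↦ ?_, fun x hx ↦ ?_⟩
    · rw [dif_pos (h.symm (⟨f t, hU⟩, z)).2]
      simp
    · have hxU : x ∈ π ⁻¹' U := by rwa [mem_preimage, hx]
      rw [dif_pos hxU]
      have : (⟨f t, hU⟩, (h ⟨x, hxU⟩).2) = h ⟨x, hxU⟩ :=
        Prod.ext (Subtype.ext (by rw [hh]; exact hx.symm)) rfl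
      rw [this, h.symm_apply_apply]

lemma union_Icc {a b c : ℝ} (hab : a ≤ b) (hbc : b ≤ c)
    (h₁ : PullbackTrivialOn F π f (Icc a b)) (h₂ : PullbackTrivialOn F π f (Icc b c)) :
    PullbackTrivialOn F π f (Icc a c) := by
  classical
  obtain ⟨r₁, s₁, hr₁, hs₁⟩ := h₁
  obtain ⟨r₂, s₂, hr₂, hs₂⟩ := h₂
  obtain ⟨cs₁, ps₁, rs₁, sr₁⟩ := hs₁ b ⟨hab, le_rfl⟩
  obtain ⟨cs₂, ps₂, rs₂, sr₂⟩ := hs₂ b ⟨le_rfl, hbc⟩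
  have c₁ : Continuous fun z ↦ r₁ (b, s₂ b z) :=
    hr₁.comp_continuous (by fun_prop) fun z ↦ ⟨⟨hab, le_rfl⟩, ps₂ z⟩
  have c₂ : Continuous fun z ↦ r₂ (b, s₁ b z) :=
    hr₂.comp_continuous (by fun_prop) fun z ↦ ⟨⟨le_rfl, hbc⟩, ps₁ z⟩
  refine ⟨fun p ↦ if p.1 ≤ b then r₁ p else r₁ (b, s₂ b (r₂ p)),
    fun t z ↦ if t ≤ b then s₁ t z else s₂ t (r₂ (b, s₁ b z)), ?_, fun t ht ↦ ?_⟩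
  · refine ContinuousOn.if (fun p hp ↦ ?_) (hr₁.mono fun p hp ↦ ?_)
      (c₁.comp_continuousOn (hr₂.mono fun p hp ↦ ?_))
    · obtain ⟨⟨-, hp⟩, hp'⟩ := hp
      have : p.1 = b := frontier_le_subset_eq (f := Prod.fst) (g := fun _ : ℝ × E ↦ b)
        continuous_fst continuous_const hp'
      obtain ⟨t, x⟩ := p
      obtain rfl : t = b := this
      rw [sr₂ x hp]
    · have : p.1 ≤ b := (closure_le_eq (f := Prod.fst) (g := fun _ : ℝ × E ↦ b)
        continuous_fst continuous_const).subset hp.2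
      exact ⟨⟨hp.1.1.1, this⟩, hp.1.2⟩
    · have hp' := hp.2
      simp only [not_le] at hp'
      have : b ≤ p.1 := closure_lt_subset_le continuous_const continuous_fst hp'
      exact ⟨⟨this, hp.1.1.2⟩, hp.1.2⟩
  · by_cases htb : t ≤ b
    · simpa only [if_pos htb] using hs₁ t ⟨ht.1, htb⟩
    · obtain ⟨cs, ps, rs, sr⟩ := hs₂ t ⟨(not_le.1 htb).le, ht.2⟩
      simp only [if_neg htb]
      refine ⟨cs.comp c₂, fun z ↦ ps _, fun z ↦ ?_, fun x hx ↦ ?_⟩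
      · rw [rs, sr₂ _ (ps₁ z), rs₁]
      · rw [sr₁ _ (ps₂ _), rs₂, sr x hx]

lemma Icc_of_locally {a b : ℝ} (hab : a ≤ b)
    (h : ∀ t, ∃ V : Set ℝ, IsOpen V ∧ t ∈ V ∧ PullbackTrivialOn F π f V) :
    PullbackTrivialOn F π f (Icc a b) := by
  choose V hV htV hVt using h
  obtain ⟨t, t_zero, t_mono, ⟨m, hm⟩, ht⟩ := exists_monotone_Icc_subset_open_cover_Icc hab
    (c := fun i ↦ Subtype.val ⁻¹' V i) (fun i ↦ (hV i).preimage continuous_subtype_val)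
    fun x _ ↦ mem_iUnion.2 ⟨x, htV x⟩
  have step (n : ℕ) : PullbackTrivialOn F π f (Icc (t n : ℝ) (t (n + 1))) := by
    obtain ⟨i, hi⟩ := ht n
    exact (hVt i).mono fun x hx ↦ hi (a := ⟨x, (t n).2.1.trans hx.1, hx.2.trans (t (n + 1)).2.2⟩) hx
  have key (n : ℕ) : PullbackTrivialOn F π f (Icc a (t n)) := by
    induction n with
    | zero => rw [t_zero, Icc_self]; exact (hVt a).mono (singleton_subset_iff.2 (htV a))
    | succ n ih => exact ih.union_Icc (t n).2.1 (t_mono n.le_succ) (step n)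
  simpa [hm m le_rfl] using key m

end PullbackTrivialOn

/-- If the pullback of `π : E → B` along a covering map `f : ℝ → B` is locally trivial, then the
inclusion of a fiber of `π` is injective on fundamental groups. -/
theorem FundamentalGroup.map_fiber_injective {E B F : Type*} [TopologicalSpace E]
    [TopologicalSpace B] [TopologicalSpace F] {π : E → B} (hπ : Continuous π) {f : ℝ → B}
    (hf : IsCoveringMap f)
    (h : ∀ t, ∃ V : Set ℝ, IsOpen V ∧ t ∈ V ∧ PullbackTrivialOn F π f V)
    {t₀ : ℝ} (i : C(F, E)) (q : E → F) (hi : ∀ z, π (i z) = f t₀)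
    (hq : ContinuousOn q (π ⁻¹' {f t₀})) (hqi : ∀ z, q (i z) = z) (z₀ : F) :
    Function.Injective (FundamentalGroup.map i z₀) := by
  rw [injective_iff_map_eq_one]
  intro p hp
  induction p using Path.Homotopic.Quotient.ind with | mk γ
  have hγ : (γ.map i.continuous).Homotopic (Path.refl (i z₀)) :=
    Path.Homotopic.Quotient.exact hp
  obtain ⟨H⟩ := hγ
  have hH0 (x : I) : H (0, x) = i (γ x) := H.apply_zero x
  have hH1 (x : I) : H (1, x) = i z₀ := H.apply_one x
  have hHs (s x : I) (hx : x ∈ ({0, 1} : Set I)) : H (s, x) = i z₀ :=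
    (H.prop' s x hx).trans <| by rcases hx with rfl | rfl <;> simp
  have lift0 : ∀ x, (ContinuousMap.comp ⟨π, hπ⟩ H.toContinuousMap) (0, x) =
      f (ContinuousMap.const I t₀ x) := fun x ↦ (congrArg π (hH0 x)).trans (hi _)
  let K := hf.liftHomotopy (ContinuousMap.comp ⟨π, hπ⟩ H.toContinuousMap) (.const I t₀) lift0
  have hK (y : I × I) : π (H y) = f (K y) := (congrFun (hf.liftHomotopy_lifts _ _ lift0) y).symm
  have hK0 (x : I) : K (0, x) = t₀ := hf.liftHomotopy_zero _ _ lift0 x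
  have hKs (s x : I) (hx : x ∈ ({0, 1} : Set I)) : K (s, x) = t₀ := by
    rw [← hK0 x]
    refine hf.const_of_comp (g := fun s ↦ K (s, x)) (by fun_prop) (fun s s' ↦ ?_) s 0
    rw [← hK, ← hK, hHs s x hx, hHs s' x hx]
  have hK1 (x : I) : K (1, x) = t₀ := by
    rw [← hKs 1 0 (by simp)]
    refine hf.const_of_comp (g := fun x ↦ K (1, x)) (by fun_prop) (fun s s' ↦ ?_) x 0
    rw [← hK, ← hK, hH1, hH1]
  obtain ⟨a, ha⟩ := (isCompact_range K.continuous).bddBelow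
  obtain ⟨b, hb⟩ := (isCompact_range K.continuous).bddAbove
  have hmem (y : I × I) : K y ∈ Icc a b := ⟨ha ⟨y, rfl⟩, hb ⟨y, rfl⟩⟩
  have ht₀ : t₀ ∈ Icc a b := hK0 0 ▸ hmem (0, 0)
  obtain ⟨r, s, hr, hs⟩ := PullbackTrivialOn.Icc_of_locally (ht₀.1.trans ht₀.2) h
  obtain ⟨cs, ps, -, sr⟩ := hs t₀ ht₀
  have hc : Continuous fun y ↦ q (s t₀ (r (K y, H y))) :=
    hq.comp_continuous (cs.comp (hr.comp_continuous (by fun_prop) fun y ↦ ⟨hmem y, hK y⟩))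
      fun y ↦ ps _
  have val {y : I × I} {z : F} (hy : K y = t₀) (hz : H y = i z) :
      q (s t₀ (r (K y, H y))) = z := by rw [hy, hz, sr _ (hi z), hqi]
  refine Path.Homotopic.Quotient.eq.2 ⟨(⟨⟨⟨_, hc⟩, fun x ↦ val (hK0 x) (hH0 x),
    fun x ↦ val (hK1 x) (hH1 x)⟩, fun s x hx ↦ ?_⟩ : Path.Homotopy γ (Path.refl z₀))⟩
  refine (val (hKs s x hx) (hHs s x hx)).trans ?_
  rcases hx with rfl | rfl <;> simp

theorem Circle.exists_fundamentalGroup_zpow_ne_one (z : Circle) :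
    ∃ g : FundamentalGroup Circle z, ∀ n : ℤ, n ≠ 0 → g ^ n ≠ 1 := by
  obtain ⟨t, ht⟩ := Circle.exp_surjective z
  let φ := Circle.isAddQuotientCoveringMap_exp.fundamentalGroupEquiv (x := z) ⟨t, ht⟩
  let c : (Multiplicative (AddSubgroup.zmultiples (2 * Real.pi)))ᵐᵒᵖ :=
    .op (.ofAdd ⟨2 * Real.pi, AddSubgroup.mem_zmultiples _⟩)
  refine ⟨φ.symm c, fun n hn h ↦ ?_⟩
  rw [← map_zpow, map_eq_one_iff _ φ.symm.injective] at h
  have h' := congrArg (fun u ↦ ((u.unop).toAdd : ℝ)) h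
  simp [c, hn, Real.pi_ne_zero] at h'

theorem not_isCyclic_of_zpow_ne_one {G H K : Type*} [Group G] [Group H] [Group K]
    (φ : G →* H) (ψ : G →* K) {a b : G} (hψa : ψ a = 1) (hφb : φ b = 1)
    (ha : ∀ n : ℤ, n ≠ 0 → φ a ^ n ≠ 1) (hb : ∀ n : ℤ, n ≠ 0 → ψ b ^ n ≠ 1) :
    ¬ IsCyclic G := by
  rintro ⟨c, hc⟩
  obtain ⟨m, rfl⟩ := hc a
  obtain ⟨n, rfl⟩ := hc b
  simp only at *
  have hn : n = 0 := by
    by_contra hn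
    refine ha n hn ?_
    rw [← map_zpow, ← zpow_mul, mul_comm, zpow_mul, map_zpow, hφb, one_zpow]
  exact hb 1 one_ne_zero (by simp [hn])

theorem FundamentalGroup.torus_not_isCyclic (z : Circle × Circle) :
    ¬ IsCyclic (FundamentalGroup (Circle × Circle) z) := by
  obtain ⟨z, w⟩ := z
  obtain ⟨g, hg⟩ := Circle.exists_fundamentalGroup_zpow_ne_one z
  obtain ⟨k, hk⟩ := Circle.exists_fundamentalGroup_zpow_ne_one w
  induction g using Path.Homotopic.Quotient.ind with | mk γ
  induction k using Path.Homotopic.Quotient.ind with | mk δ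
  exact not_isCyclic_of_zpow_ne_one (G := FundamentalGroup (Circle × Circle) (z, w))
    (FundamentalGroup.map ContinuousMap.fst (z, w))
    (FundamentalGroup.map ContinuousMap.snd (z, w))
    (a := FundamentalGroup.fromPath (.mk (γ.prod (Path.refl w))))
    (b := FundamentalGroup.fromPath (.mk ((Path.refl z).prod δ))) rfl rfl hg hk

/-- If `π : E → S¹` is a fiber bundle projection with fiber the 2-torus `T² = S¹ × S¹`
(a continuous surjection that is locally trivial with typical fiber `T²`), then for any
basepoint `e ∈ E`, the fundamental group `π₁(E, e)` is not cyclic. -/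
theorem torus_bundle_over_circle_fundamental_group_not_cyclic
    {E : Type*} [TopologicalSpace E] [Nonempty E]
    (π : E → Circle) (hcont : Continuous π) (hsurj : Function.Surjective π)
    (htriv : ∀ b : Circle, ∃ U : Set Circle, IsOpen U ∧ b ∈ U ∧
      ∃ h : (π ⁻¹' U) ≃ₜ U × (Circle × Circle),
        ∀ x : π ⁻¹' U, ((h x).1 : Circle) = π x)
    (e : E) : ¬ IsCyclic (FundamentalGroup E e) := by
  have hloc (t : ℝ) : ∃ V : Set ℝ, IsOpen V ∧ t ∈ V ∧
      PullbackTrivialOn (Circle × Circle) π Circle.exp V := by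
    obtain ⟨U, hU, htU, h, hh⟩ := htriv (Circle.exp t)
    exact ⟨Circle.exp ⁻¹' U, hU.preimage Circle.exp.continuous, htU,
      .of_homeomorph h hh fun _ ↦ id⟩
  obtain ⟨t, ht⟩ := Circle.exp_surjective (π e)
  obtain ⟨V, -, htV, r, s, hr, hs⟩ := hloc t
  obtain ⟨cs, ps, rs, sr⟩ := hs t htV
  have hinj := FundamentalGroup.map_fiber_injective hcont Circle.isCoveringMap_exp hloc
    ⟨s t, cs⟩ (fun x ↦ r (t, x)) ps
    (hr.comp (by fun_prop) fun x hx ↦ ⟨htV, hx⟩) rs (r (t, e))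
  have he : (⟨s t, cs⟩ : C(Circle × Circle, E)) (r (t, e)) = e := sr e ht.symm
  intro hcyc
  rw [← he] at hcyc
  exact FundamentalGroup.torus_not_isCyclic _ (isCyclic_of_injective _ hinj)
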